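/- Let A ∈ ℂ^{m×n} be a matrix, q ≥ 2 a real number, r_1,…,r_m ∈ ℂ^n the conjugate transposes of the m rows of A, λ > 0, and let w ∈ ℂ^n satisfy ‖w‖_2 = 1. If |⟨w, r_i⟩| ≤ λ‖A‖_{2→∞} for all i = 1,…,m, then ‖Aw‖_q ≤ λ^{(q−2)/q} · ‖A‖_{2→∞}^{(q−2)/q} · ‖A‖_{2→2}^{2/q}. -/

import Mathlib

open scoped BigOperators

/-- The `ℓ_p` norm of a vector, for a real exponent `p`. -/
noncomputable def lpnorm {n : ℕ} {𝕜 : Type*} [RCLike 𝕜] (p : ℝ) (x : Fin n → 𝕜) : ℝ :=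
  (∑ i, ‖x i‖ ^ p) ^ (1 / p)

/-- The `ℓ_∞` norm of a vector. -/
noncomputable def linorm {n : ℕ} {𝕜 : Type*} [RCLike 𝕜] (x : Fin n → 𝕜) : ℝ :=
  ⨆ i, ‖x i‖

/-- The `p → q` operator norm of a matrix: `max_{x ≠ 0} ‖Ax‖_q / ‖x‖_p`. -/
noncomputable def opNorm {m n : ℕ} {𝕜 : Type*} [RCLike 𝕜] (p q : ℝ)
    (A : Matrix (Fin m) (Fin n) 𝕜) : ℝ :=
  ⨆ x : {x : Fin n → 𝕜 // x ≠ 0}, lpnorm q (A.mulVec x.1) / lpnorm p x.1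

/-- The `p → ∞` operator norm of a matrix: `max_{x ≠ 0} ‖Ax‖_∞ / ‖x‖_p`. -/
noncomputable def opNormInf {m n : ℕ} {𝕜 : Type*} [RCLike 𝕜] (p : ℝ)
    (A : Matrix (Fin m) (Fin n) 𝕜) : ℝ :=
  ⨆ x : {x : Fin n → 𝕜 // x ≠ 0}, linorm (A.mulVec x.1) / lpnorm p x.1

/-- `row A i` is the conjugate transpose of the `i`-th row of `A`,
so that `(A x) i = ⟨x, row A i⟩` for the standard Hermitian inner product. -/
def row {m n : ℕ} {𝕜 : Type*} [RCLike 𝕜] (A : Matrix (Fin m) (Fin n) 𝕜) (i : Fin m) :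
    Fin n → 𝕜 := fun k => star (A i k)

/-- The standard Hermitian inner product `⟨x, y⟩ = ∑ k, x k * conj (y k)`. -/
noncomputable def hinner {n : ℕ} (x y : Fin n → ℂ) : ℂ := ∑ k, x k * star (y k)

theorem lpnorm_two_eq_norm_toLp {n : ℕ} {𝕜 : Type*} [RCLike 𝕜] (x : Fin n → 𝕜) :
    lpnorm 2 x = ‖WithLp.toLp 2 x‖ := by
  simp [lpnorm, EuclideanSpace.norm_eq, Real.sqrt_eq_rpow]

theorem lpnorm_nonneg {n : ℕ} {𝕜 : Type*} [RCLike 𝕜] (p : ℝ) (x : Fin n → 𝕜) :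
    0 ≤ lpnorm p x :=
  Real.rpow_nonneg (Finset.sum_nonneg fun _ _ => Real.rpow_nonneg (norm_nonneg _) _) _

theorem opNormInf_nonneg {m n : ℕ} {𝕜 : Type*} [RCLike 𝕜] (p : ℝ)
    (A : Matrix (Fin m) (Fin n) 𝕜) : 0 ≤ opNormInf p A :=
  Real.iSup_nonneg fun x =>
    div_nonneg (Real.iSup_nonneg fun _ => norm_nonneg _) (lpnorm_nonneg p x.1)

theorem bddAbove_lpnorm_two_mulVec_div {m n : ℕ} {𝕜 : Type*} [RCLike 𝕜]
    (A : Matrix (Fin m) (Fin n) 𝕜) :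
    BddAbove (Set.range fun x : {x : Fin n → 𝕜 // x ≠ 0} =>
      lpnorm 2 (A.mulVec x.1) / lpnorm 2 x.1) := by
  refine ⟨‖(Matrix.toLpLin 2 2 A).toContinuousLinearMap‖, ?_⟩
  rintro _ ⟨x, rfl⟩
  refine div_le_of_le_mul₀ (lpnorm_nonneg _ _) (norm_nonneg _) ?_
  rw [lpnorm_two_eq_norm_toLp, lpnorm_two_eq_norm_toLp]
  exact (Matrix.toLpLin 2 2 A).toContinuousLinearMap.le_opNorm (WithLp.toLp 2 x.1)

theorem lpnorm_two_mulVec_le_opNorm {m n : ℕ} {𝕜 : Type*} [RCLike 𝕜]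
    (A : Matrix (Fin m) (Fin n) 𝕜) {w : Fin n → 𝕜} (hw : lpnorm 2 w = 1) :
    lpnorm 2 (A.mulVec w) ≤ opNorm 2 2 A := by
  have hw0 : w ≠ 0 := by
    rintro rfl
    simp [lpnorm_two_eq_norm_toLp] at hw
  simpa [hw, opNorm] using le_ciSup (bddAbove_lpnorm_two_mulVec_div A) ⟨w, hw0⟩

theorem hinner_row {m n : ℕ} (A : Matrix (Fin m) (Fin n) ℂ) (w : Fin n → ℂ) (i : Fin m) :
    hinner w (row A i) = A.mulVec w i := by
  simp [hinner, row, Matrix.mulVec, dotProduct, mul_comm]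

/-- Interpolation between `ℓ_2` and a uniform bound on the entries. -/
theorem lpnorm_le_of_norm_le {n : ℕ} {𝕜 : Type*} [RCLike 𝕜] {q B : ℝ} (hq : 2 ≤ q)
    (hB : 0 ≤ B) (y : Fin n → 𝕜) (hy : ∀ i, ‖y i‖ ≤ B) :
    lpnorm q y ≤ B ^ ((q - 2) / q) * lpnorm 2 y ^ (2 / q) := by
  have hS : 0 ≤ ∑ i, ‖y i‖ ^ (2 : ℝ) :=
    Finset.sum_nonneg fun _ _ => Real.rpow_nonneg (norm_nonneg _) _
  have hsum : ∑ i, ‖y i‖ ^ q ≤ B ^ (q - 2) * ∑ i, ‖y i‖ ^ (2 : ℝ) := by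
    rw [Finset.mul_sum]
    refine Finset.sum_le_sum fun i _ => ?_
    calc ‖y i‖ ^ q = ‖y i‖ ^ (q - 2) * ‖y i‖ ^ (2 : ℝ) := by
          rw [← Real.rpow_add_of_nonneg (norm_nonneg _) (by linarith) (by norm_num),
            sub_add_cancel]
      _ ≤ B ^ (q - 2) * ‖y i‖ ^ (2 : ℝ) :=
          mul_le_mul_of_nonneg_right
            (Real.rpow_le_rpow (norm_nonneg _) (hy i) (by linarith))
            (Real.rpow_nonneg (norm_nonneg _) _)
  calc lpnorm q y ≤ (B ^ (q - 2) * ∑ i, ‖y i‖ ^ (2 : ℝ)) ^ (1 / q) :=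
        Real.rpow_le_rpow (Finset.sum_nonneg fun _ _ => Real.rpow_nonneg (norm_nonneg _) _)
          hsum (by positivity)
    _ = B ^ ((q - 2) / q) * lpnorm 2 y ^ (2 / q) := by
        rw [Real.mul_rpow (Real.rpow_nonneg hB _) hS, ← Real.rpow_mul hB, lpnorm,
          ← Real.rpow_mul hS]
        congr 2 <;> ring

theorem stmt6 {m n : ℕ} (q : ℝ) (hq : 2 ≤ q) (A : Matrix (Fin m) (Fin n) ℂ)
    (lam : ℝ) (hlam : 0 < lam) (w : Fin n → ℂ) (hw : lpnorm 2 w = 1)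
    (h : ∀ i : Fin m, ‖hinner w (row A i)‖ ≤ lam * opNormInf 2 A) :
    lpnorm q (A.mulVec w) ≤
      lam ^ ((q - 2) / q) * opNormInf 2 A ^ ((q - 2) / q) * opNorm 2 2 A ^ (2 / q) := by
  have hN := opNormInf_nonneg 2 A
  rw [← Real.mul_rpow hlam.le hN]
  refine (lpnorm_le_of_norm_le hq (mul_nonneg hlam.le hN) _ fun i => ?_).trans ?_
  · exact hinner_row A w i ▸ h i
  · exact mul_le_mul_of_nonneg_left
      (Real.rpow_le_rpow (lpnorm_nonneg _ _) (lpnorm_two_mulVec_le_opNorm A hw) (by positivity))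
      (Real.rpow_nonneg (mul_nonneg hlam.le hN) _)
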